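/- arXiv:0802.4270 — 2 statements merged into one kernel-verified Lean document; each statement's English description precedes it below -/
import Mathlib

section
/- If there exists an F_q-linear subspace of F_q^{2n} defining a pure subsystem code with parameters [[n,k,r,d]]_q with d ≥ 2 and k ≥ 1, then there exists an F_q-linear subspace of F_q^{2n} defining a subsystem code with parameters [[n, k−1, r, d_e]]_q with d_e ≥ d that is pure to d. -/
open Matrix
open scoped Classical

/-- The symplectic vector space `F_q^{2n}`: pairs `(x|y)` with `x, y ∈ F_q^n`. -/
abbrev SV (F : Type*) (n : ℕ) := (Fin n → F) × (Fin n → F)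

/-- The symplectic weight `swt(x|y) = #{i : (x_i, y_i) ≠ (0,0)}`. -/
noncomputable def swt {F : Type*} [Zero F] {n : ℕ} (v : SV F n) : ℕ :=
  Nat.card {i : Fin n // v.1 i ≠ 0 ∨ v.2 i ≠ 0}

/-- minimum symplectic weight of a nonzero element of a set -/
noncomputable def swtSet {F : Type*} [Zero F] {n : ℕ} (S : Set (SV F n)) : ℕ :=
  sInf (swt '' {v | v ∈ S ∧ v ≠ 0})

/-- The trace-symplectic form `⟨u|v⟩ₛ = Tr_{q/p}(v₁·u₂ − u₁·v₂)`. -/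
noncomputable def trSymp (p : ℕ) {F : Type*} [Field F] [Fintype F] [CharP F p] {n : ℕ}
    (u v : SV F n) : ZMod p :=
  letI := ZMod.algebra F p
  Algebra.trace (ZMod p) F (dotProduct v.1 u.2 - dotProduct u.1 v.2)

/-- The trace-symplectic dual of a subset of `F_q^{2n}`. -/
def sdual (p : ℕ) {F : Type*} [Field F] [Fintype F] [CharP F p] {n : ℕ}
    (S : Set (SV F n)) : Set (SV F n) :=
  {v | ∀ w ∈ S, trSymp p v w = 0}

/-- `C` defines a subsystem code with parameters `((n,K,R,d))_q`, where
`K = q^n/(|C||D|)^{1/2}`, `R = (|C|/|D|)^{1/2}` for `D = C ∩ C^⊥s`, and `d` is the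
symplectic weight of `D^⊥s \ C` (resp. of `D^⊥s` if `D^⊥s = C`). -/
def IsSubsystemCode (p : ℕ) {F : Type*} [Field F] [Fintype F] [CharP F p] {n : ℕ}
    (K R d : ℕ) (C : AddSubgroup (SV F n)) : Prop :=
  C ≠ ⊥ ∧
  K ^ 2 * (Nat.card C * Nat.card ↥((C : Set (SV F n)) ∩ sdual p (C : Set (SV F n)))) =
    Fintype.card F ^ (2 * n) ∧
  R ^ 2 * Nat.card ↥((C : Set (SV F n)) ∩ sdual p (C : Set (SV F n))) = Nat.card C ∧
  d = if sdual p ((C : Set (SV F n)) ∩ sdual p (C : Set (SV F n))) = (C : Set (SV F n))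
      then swtSet (sdual p ((C : Set (SV F n)) ∩ sdual p (C : Set (SV F n))))
      else swtSet (sdual p ((C : Set (SV F n)) ∩ sdual p (C : Set (SV F n))) \ (C : Set (SV F n)))

/-- The subsystem code defined by `C` is pure to `d'`, i.e. `swt(D^⊥s) ≥ d'`. -/
def PureTo (p : ℕ) {F : Type*} [Field F] [Fintype F] [CharP F p] {n : ℕ}
    (d' : ℕ) (C : AddSubgroup (SV F n)) : Prop :=
  d' ≤ swtSet (sdual p ((C : Set (SV F n)) ∩ sdual p (C : Set (SV F n))))

/-- The `F`-bilinear symplectic form `v₁·u₂ − u₁·v₂` underlying `trSymp`. -/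
def sympForm (F : Type*) [Field F] (n : ℕ) : SV F n →ₗ[F] SV F n →ₗ[F] F :=
  LinearMap.mk₂ F (fun u v => dotProduct v.1 u.2 - dotProduct u.1 v.2)
    (fun u u' v => by simp only [Prod.fst_add, Prod.snd_add, dotProduct_add, add_dotProduct]; ring)
    (fun a u v => by
      simp only [Prod.smul_fst, Prod.smul_snd, dotProduct_smul, smul_dotProduct, smul_sub])
    (fun u v v' => by simp only [Prod.fst_add, Prod.snd_add, dotProduct_add, add_dotProduct]; ring)
    (fun a u v => by
      simp only [Prod.smul_fst, Prod.smul_snd, dotProduct_smul, smul_dotProduct, smul_sub])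

theorem sympForm_self {F : Type*} [Field F] {n : ℕ} (v : SV F n) : sympForm F n v v = 0 :=
  sub_self _

theorem sympForm_swap {F : Type*} [Field F] {n : ℕ} (u v : SV F n) :
    sympForm F n u v = -sympForm F n v u := by
  simp only [sympForm, LinearMap.mk₂_apply, neg_sub]

theorem sdual_anti (p : ℕ) {F : Type*} [Field F] [Fintype F] [CharP F p] {n : ℕ}
    {S T : Set (SV F n)} (h : S ⊆ T) : sdual p T ⊆ sdual p S :=
  fun _ hv w hw => hv w (h hw)

section Trace

variable (p : ℕ) [Fact p.Prime] {F : Type*} [Field F] [Fintype F] [CharP F p] {n : ℕ}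

theorem trSymp_add_left (u u' v : SV F n) :
    trSymp p (u + u') v = trSymp p u v + trSymp p u' v := by
  let := ZMod.algebra F p
  have h : ∀ u v : SV F n, trSymp p u v = Algebra.trace (ZMod p) F (sympForm F n u v) :=
    fun _ _ => rfl
  simp only [h, map_add, LinearMap.add_apply]

theorem trSymp_add_right (u v v' : SV F n) :
    trSymp p u (v + v') = trSymp p u v + trSymp p u v' := by
  let := ZMod.algebra F p
  have h : ∀ u v : SV F n, trSymp p u v = Algebra.trace (ZMod p) F (sympForm F n u v) :=
    fun _ _ => rfl
  simp only [h, map_add]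

theorem trSymp_eq_zero {u v : SV F n} (h : sympForm F n u v = 0) : trSymp p u v = 0 := by
  let := ZMod.algebra F p
  change Algebra.trace (ZMod p) F (sympForm F n u v) = 0
  rw [h, map_zero]

theorem subset_sdual_inter_sdual (S : Set (SV F n)) : S ⊆ sdual p (S ∩ sdual p S) := by
  intro x hx w hw
  let := ZMod.algebra F p
  have h : Algebra.trace (ZMod p) F (sympForm F n w x) = 0 := hw.2 x hx
  change Algebra.trace (ZMod p) F (sympForm F n x w) = 0
  rw [sympForm_swap, map_neg, h, neg_zero]

end Trace

/-- The lower bound `|V| ≤ |C| |C^⊥|` for the orthogonal of `C` under the symplectic form. -/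
theorem card_le_card_mul_card_orthogonal {F : Type*} [Field F] [Fintype F] {n : ℕ}
    (C : Submodule F (SV F n)) :
    Fintype.card F ^ (2 * n) ≤
      Nat.card C * Nat.card (LinearMap.ker (((sympForm F n).flip.domRestrict C).flip)) := by
  have h := LinearMap.finrank_range_add_finrank_ker ((sympForm F n).flip.domRestrict C).flip
  have hle := Submodule.finrank_le (LinearMap.range ((sympForm F n).flip.domRestrict C).flip)
  rw [Module.finrank_prod, Module.finrank_fin_fun] at h
  have hdual : Module.finrank F (C →ₗ[F] F) = Module.finrank F C := Subspace.dual_finrank_eq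
  rw [Module.natCard_eq_pow_finrank (K := F) (V := C), Module.natCard_eq_pow_finrank (K := F)
    (V := LinearMap.ker _), Nat.card_eq_fintype_card, ← pow_add]
  exact Nat.pow_le_pow_right Fintype.card_pos (by omega)

/-- Adjoining a line outside `C` to a subset of `C` multiplies its cardinality by `|F|`. -/
theorem card_image2_add_smul {F V : Type*} [Field F] [Fintype F] [AddCommGroup V] [Module F V]
    (C : Submodule F V) {v : V} (hv : v ∉ C) {S : Set V} (hS : S ⊆ C) :
    Nat.card (Set.image2 (fun s (a : F) => s + a • v) S Set.univ) =
      Nat.card S * Fintype.card F := by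
  rw [← Set.image_prod, Nat.card_image_of_injOn, Nat.card_coe_set_eq, Set.ncard_prod,
    Set.ncard_univ, Nat.card_eq_fintype_card, Nat.card_coe_set_eq]
  rintro ⟨s, a⟩ ⟨hs, -⟩ ⟨t, b⟩ ⟨ht, -⟩ (h : s + a • v = t + b • v)
  have hab : (a - b) • v ∈ C := by
    have : (a - b) • v = t - s := by rw [sub_smul, sub_eq_sub_iff_add_eq_add, add_comm, h]
    rw [this]
    exact C.sub_mem (hS ht) (hS hs)
  have : a = b := by
    by_contra hne
    exact hv ((C.smul_mem_iff (sub_ne_zero.mpr hne)).mp hab)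
  subst this
  simpa using h

theorem le_swtSet {F : Type*} [Zero F] {n d : ℕ} {S T : Set (SV F n)} (hT : d ≤ swtSet T)
    (hST : S ⊆ T) (hS : ∃ x ∈ S, x ≠ 0) : d ≤ swtSet S := by
  obtain ⟨x, hx, hx0⟩ := hS
  refine le_csInf ⟨_, x, ⟨hx, hx0⟩, rfl⟩ ?_
  rintro _ ⟨y, ⟨hy, hy0⟩, rfl⟩
  exact hT.trans (Nat.sInf_le ⟨y, ⟨hST hy, hy0⟩, rfl⟩)

/-- Reducing dimension: a pure `F_q`-linear `[[n,k,r,d]]_q` subsystem code with `d ≥ 2`,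
`k ≥ 1` gives an `F_q`-linear `[[n,k-1,r,≥d]]_q` subsystem code pure to `d`. -/
theorem stmt10 {p : ℕ} [Fact p.Prime] {F : Type} [Field F] [Fintype F] [CharP F p]
    {n k r d : ℕ} (C : Submodule F (SV F n))
    (h : IsSubsystemCode p (Fintype.card F ^ k) (Fintype.card F ^ r) d C.toAddSubgroup)
    (hpure : PureTo p d C.toAddSubgroup) (hd : 2 ≤ d) (hk : 1 ≤ k) :
    ∃ (C' : Submodule F (SV F n)) (de : ℕ), d ≤ de ∧
      IsSubsystemCode p (Fintype.card F ^ (k - 1)) (Fintype.card F ^ r) de C'.toAddSubgroup ∧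
      PureTo p d C'.toAddSubgroup := by
  obtain ⟨hC, hK, hR, -⟩ := h
  have hq : 1 < Fintype.card F := Fintype.one_lt_card
  rw [Submodule.coe_toAddSubgroup] at hK hR
  obtain ⟨v, hvorth, hv⟩ : ∃ v : SV F n, (∀ c ∈ C, sympForm F n v c = 0) ∧ v ∉ C := by
    by_contra! hcon
    have hcard := card_le_card_mul_card_orthogonal C
    have hsub : (LinearMap.ker ((sympForm F n).flip.domRestrict C).flip : Set (SV F n)) ⊆
        (C : Set (SV F n)) ∩ sdual p (C : Set (SV F n)) := by
      intro x hx
      have hx' : ∀ c ∈ C, sympForm F n x c = 0 := fun c hc =>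
        LinearMap.congr_fun (LinearMap.mem_ker.mp hx) ⟨c, hc⟩
      exact ⟨hcon x hx', fun c hc => trSymp_eq_zero p (hx' c hc)⟩
    have hle := hcard.trans (Nat.mul_le_mul_left _ (Nat.card_mono (Set.toFinite _) hsub))
    have hpos : 0 < Fintype.card F ^ (2 * n) := by positivity
    rw [← hK] at hle hpos
    have hk' : 1 < (Fintype.card F ^ k) ^ 2 := one_lt_pow₀ (one_lt_pow₀ hq (by omega)) two_ne_zero
    exact absurd hle (not_le.mpr (lt_mul_of_one_lt_left (Nat.pos_of_mul_pos_left hpos) hk'))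
  have hC'mem : ∀ x, x ∈ C ⊔ F ∙ v ↔ ∃ c ∈ C, ∃ a : F, c + a • v = x := by
    intro x
    simp only [Submodule.mem_sup, Submodule.mem_span_singleton, exists_exists_eq_and]
  have hvC : ∀ (a : F), ∀ c ∈ C, trSymp p (a • v) c = 0 ∧ trSymp p c (a • v) = 0 := by
    intro a c hc
    constructor <;> apply trSymp_eq_zero
    · rw [map_smul, LinearMap.smul_apply, hvorth c hc, smul_zero]
    · rw [map_smul, sympForm_swap, hvorth c hc, neg_zero, smul_zero]
  have hvv : ∀ a b : F, trSymp p (a • v) (b • v) = 0 := fun a b => trSymp_eq_zero p (by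
    rw [map_smul, map_smul, LinearMap.smul_apply, sympForm_self, smul_zero, smul_zero])
  have hCset : ((C ⊔ F ∙ v : Submodule F (SV F n)) : Set (SV F n)) =
      Set.image2 (fun s (a : F) => s + a • v) C Set.univ := by
    ext x
    simp [hC'mem]
  have hDset : ((C ⊔ F ∙ v : Submodule F (SV F n)) : Set (SV F n)) ∩
      sdual p ((C ⊔ F ∙ v : Submodule F (SV F n)) : Set (SV F n)) =
      Set.image2 (fun s (a : F) => s + a • v)
        ((C : Set (SV F n)) ∩ sdual p (C : Set (SV F n))) Set.univ := by
    ext x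
    constructor
    · rintro ⟨hx, hxd⟩
      obtain ⟨c, hc, a, rfl⟩ := (hC'mem x).mp hx
      refine ⟨c, ⟨hc, fun w hw => ?_⟩, a, trivial, rfl⟩
      have := hxd w (Submodule.mem_sup_left hw)
      rwa [trSymp_add_left, (hvC a w hw).1, add_zero] at this
    · rintro ⟨c, ⟨hc, hcd⟩, a, -, rfl⟩
      refine ⟨(hC'mem _).mpr ⟨c, hc, a, rfl⟩, fun w hw => ?_⟩
      obtain ⟨c', hc', b, rfl⟩ := (hC'mem w).mp hw
      rw [trSymp_add_left, trSymp_add_right, trSymp_add_right, hcd c' hc', (hvC b c hc).2,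
        (hvC a c' hc').1, hvv]
      simp
  have hcardC : Nat.card (C ⊔ F ∙ v : Submodule F (SV F n)) = Nat.card C * Fintype.card F :=
    (congrArg (fun S : Set (SV F n) => Nat.card S) hCset).trans
      (card_image2_add_smul C hv subset_rfl)
  have hcardD := card_image2_add_smul (F := F) C hv
    (Set.inter_subset_left (s := (C : Set (SV F n))) (t := sdual p (C : Set (SV F n))))
  rw [← hDset] at hcardD
  have hDD : (C : Set (SV F n)) ∩ sdual p (C : Set (SV F n)) ⊆
      ((C ⊔ F ∙ v : Submodule F (SV F n)) : Set (SV F n)) ∩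
      sdual p ((C ⊔ F ∙ v : Submodule F (SV F n)) : Set (SV F n)) := by
    rw [hDset]
    exact fun x hx => ⟨x, hx, 0, trivial, by simp⟩
  have hv0 : v ≠ 0 := fun h0 => hv (h0 ▸ C.zero_mem)
  have hvC' : v ∈ C ⊔ F ∙ v := Submodule.mem_sup_right (Submodule.mem_span_singleton_self v)
  have hpure' : PureTo p d (C ⊔ F ∙ v : Submodule F (SV F n)).toAddSubgroup :=
    le_swtSet hpure (sdual_anti p hDD) ⟨v, subset_sdual_inter_sdual p _ hvC', hv0⟩
  refine ⟨C ⊔ F ∙ v, _, ?_, ⟨?_, ?_, ?_, rfl⟩, hpure'⟩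
  · split_ifs with heq
    · exact hpure'
    · obtain ⟨x, hx, hxC⟩ := Set.exists_of_ssubset
        ((subset_sdual_inter_sdual p _).ssubset_of_ne (Ne.symm heq))
      exact le_swtSet hpure' Set.sdiff_subset
        ⟨x, ⟨hx, hxC⟩, fun h0 => hxC (h0 ▸ zero_mem _)⟩
  · intro hbot
    exact hv0 ((AddSubgroup.mem_bot).mp (hbot ▸ hvC'))
  · rw [Submodule.coe_toAddSubgroup, hcardD, ← hK]
    change _ * (Nat.card (C ⊔ F ∙ v : Submodule F (SV F n)) * _) = _ * (Nat.card C * _)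
    obtain ⟨k, rfl⟩ := Nat.exists_eq_add_of_le' hk
    rw [hcardC, Nat.add_sub_cancel]
    ring
  · rw [Submodule.coe_toAddSubgroup, hcardD]
    change _ = Nat.card (C ⊔ F ∙ v : Submodule F (SV F n))
    rw [hcardC, ← mul_assoc, hR]
    rfl
end

section
/- Let q be a prime power and m a positive integer. If there exists an additive subgroup of F_{q^m}^{2n} defining a pure subsystem code with parameters ((n,K,R,d))_{q^m}, then there exists an additive subgroup of F_q^{2nm} defining a pure subsystem code with parameters ((nm, K, R, d'))_q with d' ≥ d. Conversely, if there exists an additive subgroup of F_q^{2nm} defining a pure subsystem code with parameters ((nm, K, R, d))_q, then there exists an additive subgroup of F_{q^m}^{2n} defining a subsystem code with parameters ((n, K, R, d''))_{q^m} with d'' ≥ ⌊d/m⌋. -/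
open Matrix
open scoped Classical

/-- The trace from `F_q` to `F_p` as an additive map. -/
noncomputable def primeTrace (p : ℕ) (F : Type*) [Field F] [Fintype F] [CharP F p] :
    F →+ ZMod p :=
  letI := ZMod.algebra F p
  (Algebra.trace (ZMod p) F).toAddMonoidHom

theorem trSymp_eq_primeTrace (p : ℕ) {F : Type*} [Field F] [Fintype F] [CharP F p] {n : ℕ}
    (u v : SV F n) : trSymp p u v = primeTrace p F (v.1 ⬝ᵥ u.2 - u.1 ⬝ᵥ v.2) := rfl

/-- A unimodular `2 × 2` substitution as an additive automorphism of the plane. -/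
def planeEquiv {E : Type*} [Field E] (a b c d : E) (h : a * d - b * c = 1) :
    (E × E) ≃+ (E × E) where
  toFun v := (a * v.1 + b * v.2, c * v.1 + d * v.2)
  invFun v := (d * v.1 - b * v.2, a * v.2 - c * v.1)
  left_inv v := by
    ext
    · simp only; linear_combination v.1 * h
    · simp only; linear_combination v.2 * h
  right_inv v := by
    ext
    · simp only; linear_combination v.1 * h
    · simp only; linear_combination v.2 * h
  map_add' u v := by
    ext <;> simp only [Prod.fst_add, Prod.snd_add] <;> ring

/-- `SL₂` is transitive on nonzero vectors and preserves the determinant. -/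
theorem exists_planeEquiv {E : Type*} [Field E] (w : E × E) (hw : w ≠ 0) (t : E) (ht : t ≠ 0) :
    ∃ σ : (E × E) ≃+ (E × E), σ w = (t, 0) ∧
      ∀ u v, (σ v).1 * (σ u).2 - (σ u).1 * (σ v).2 = v.1 * u.2 - u.1 * v.2 := by
  obtain ⟨a, b, c, d, h, h₁, h₂⟩ : ∃ a b c d : E, a * d - b * c = 1 ∧
      a * w.1 + b * w.2 = t ∧ c * w.1 + d * w.2 = 0 := by
    by_cases h1 : w.1 = 0
    · have h2 : w.2 ≠ 0 := fun h2 => hw (Prod.ext h1 h2)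
      refine ⟨0, t * w.2⁻¹, -(w.2 * t⁻¹), 0, ?_, ?_, ?_⟩
      · field_simp; ring
      · field_simp; ring
      · simp [h1]
    · refine ⟨t * w.1⁻¹, 0, -(w.2 * t⁻¹), w.1 * t⁻¹, ?_, ?_, ?_⟩
      · field_simp; ring
      · field_simp; ring
      · ring
  refine ⟨planeEquiv a b c d h, Prod.ext h₁ h₂, fun u v => ?_⟩
  simp only [planeEquiv, AddEquiv.coe_mk, Equiv.coe_fn_mk]
  linear_combination (v.1 * u.2 - u.1 * v.2) * h

/-- Dual additive coordinates: `E` and `F^m` carry matching trace pairings. -/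
theorem exists_dual_addEquiv {p : ℕ} [Fact p.Prime] {F E : Type*} [Field F] [Fintype F]
    [CharP F p] [Field E] [Fintype E] [CharP E p] {m : ℕ}
    (hcard : Fintype.card E = Fintype.card F ^ m) :
    ∃ α β : E ≃+ (Fin m → F), ∀ a b,
      primeTrace p F (α a ⬝ᵥ β b) = primeTrace p E (a * b) := by
  let _ := ZMod.algebra F p
  let _ := ZMod.algebra E p
  have hfr : Module.finrank (ZMod p) E = Module.finrank (ZMod p) (Fin m → F) := by
    have h1 := Module.card_eq_pow_finrank (K := ZMod p) (V := E)
    have h2 := Module.card_eq_pow_finrank (K := ZMod p) (V := Fin m → F)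
    rw [Fintype.card_fun, Fintype.card_fin, ← hcard, h1, ZMod.card] at h2
    exact Nat.pow_right_injective (Fact.out : p.Prime).two_le h2
  obtain ⟨α⟩ := FiniteDimensional.nonempty_linearEquiv_of_finrank_eq hfr
  let B : LinearMap.BilinForm (ZMod p) (Fin m → F) :=
    LinearMap.mk₂ (ZMod p) (fun x y => Algebra.trace (ZMod p) F (x ⬝ᵥ y))
      (by intros; simp [add_dotProduct]) (by intros; simp [smul_dotProduct])
      (by intros; simp [dotProduct_add]) (by intros; simp [dotProduct_smul])
  have hB : B.Nondegenerate := by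
    have key : ∀ x : Fin m → F, (∀ y, Algebra.trace (ZMod p) F (x ⬝ᵥ y) = 0) → x = 0 := by
      intro x hx
      funext j
      refine (traceForm_nondegenerate (ZMod p) F).1 (x j) fun y => ?_
      simpa [Algebra.traceForm_apply] using hx (Pi.single j y)
    refine ⟨fun x hx => key x hx, fun x hx => key x fun y => ?_⟩
    rw [dotProduct_comm]
    exact hx y
  have hBs : ∀ x y, B x y = B y x := fun x y => by
    simp [B, dotProduct_comm]
  let β : E ≃ₗ[ZMod p] (Fin m → F) :=
    ((Algebra.traceForm (ZMod p) E).toDual (traceForm_nondegenerate _ _)).trans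
      (α.symm.dualMap.trans (B.toDual hB).symm)
  refine ⟨α.toAddEquiv, β.toAddEquiv, fun a b => ?_⟩
  have h : B (β b) (α a) = Algebra.traceForm (ZMod p) E b a := by
    simp [β, LinearMap.BilinForm.apply_toDual_symm_apply, LinearMap.BilinForm.toDual_def]
  rw [hBs, Algebra.traceForm_apply, mul_comm] at h
  exact h

/-- A single coordinate over `F_{q^m}` expands isometrically to `m` coordinates over `F_q`, in such
a way that a prescribed vector has weight at most one. -/
theorem exists_block_addEquiv {p : ℕ} [Fact p.Prime] {F E : Type*} [Field F] [Fintype F]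
    [CharP F p] [Field E] [Fintype E] [CharP E p] {m : ℕ} (hm : 0 < m)
    (hcard : Fintype.card E = Fintype.card F ^ m) (w : E × E) :
    ∃ ψ : (E × E) ≃+ SV F m,
      (∀ u v, trSymp p (ψ u) (ψ v) = primeTrace p E (v.1 * u.2 - u.1 * v.2)) ∧
      ∃ j, ∀ k, (ψ w).1 k ≠ 0 ∨ (ψ w).2 k ≠ 0 → k = j := by
  obtain ⟨α, β, hαβ⟩ := exists_dual_addEquiv (p := p) hcard
  let e : Fin m → F := Pi.single ⟨0, hm⟩ 1
  have he : α.symm e ≠ 0 := by simp [e]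
  obtain ⟨σ, hσw, hσ⟩ : ∃ σ : (E × E) ≃+ (E × E), (σ w = (α.symm e, 0) ∨ w = 0) ∧
      ∀ u v, (σ v).1 * (σ u).2 - (σ u).1 * (σ v).2 = v.1 * u.2 - u.1 * v.2 := by
    by_cases hw : w = 0
    · exact ⟨AddEquiv.refl _, Or.inr hw, fun u v => rfl⟩
    · obtain ⟨σ, h₁, h₂⟩ := exists_planeEquiv w hw _ he
      exact ⟨σ, Or.inl h₁, h₂⟩
  refine ⟨σ.trans (α.prodCongr β), fun u v => ?_, ⟨0, hm⟩, fun k => ?_⟩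
  · rw [trSymp_eq_primeTrace, ← hσ, map_sub, map_sub, ← hαβ, ← hαβ]
    rfl
  · contrapose!
    intro hk
    rcases hσw with h | h
    · rw [AddEquiv.trans_apply, h]
      change α (α.symm e) k = 0 ∧ β 0 k = 0
      simp [e, hk]
    · simp [h]

/-- Blockwise expansion of symplectic vectors. -/
def expand {E F : Type*} [AddCommGroup E] [AddCommGroup F] {n m : ℕ}
    (ψ : Fin n → (E × E) ≃+ SV F m) : SV E n ≃+ SV F (n * m) where
  toFun v := (fun k => (ψ k.divNat (v.1 k.divNat, v.2 k.divNat)).1 k.modNat,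
    fun k => (ψ k.divNat (v.1 k.divNat, v.2 k.divNat)).2 k.modNat)
  invFun v := (fun i => ((ψ i).symm (fun j => v.1 (finProdFinEquiv (i, j)),
      fun j => v.2 (finProdFinEquiv (i, j)))).1,
    fun i => ((ψ i).symm (fun j => v.1 (finProdFinEquiv (i, j)),
      fun j => v.2 (finProdFinEquiv (i, j)))).2)
  left_inv v := by
    have h (i : Fin n) (j : Fin m) : (finProdFinEquiv (i, j)).divNat = i ∧
        (finProdFinEquiv (i, j)).modNat = j :=
      Prod.ext_iff.1 (finProdFinEquiv.symm_apply_apply (i, j))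
    ext i <;> simp [(h _ _).1, (h _ _).2]
  right_inv v := by
    have h (k : Fin (n * m)) : finProdFinEquiv (k.divNat, k.modNat) = k :=
      finProdFinEquiv.apply_symm_apply k
    ext k <;> simp [h]
  map_add' u v := by
    have h (k : Fin n) : ψ k (u.1 k + v.1 k, u.2 k + v.2 k) =
      ψ k (u.1 k, u.2 k) + ψ k (v.1 k, v.2 k) := by rw [← map_add]; rfl
    ext k <;> simp [h]

theorem trSymp_expand {p : ℕ} {F E : Type*} [Field F] [Fintype F] [CharP F p] [Field E]
    [Fintype E] [CharP E p] {n m : ℕ} (ψ : Fin n → (E × E) ≃+ SV F m)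
    (hψ : ∀ i u v, trSymp p (ψ i u) (ψ i v) = primeTrace p E (v.1 * u.2 - u.1 * v.2))
    (u v : SV E n) : trSymp p (expand ψ u) (expand ψ v) = trSymp p u v := by
  simp only [trSymp_eq_primeTrace, dotProduct, ← Finset.sum_sub_distrib, map_sum] at hψ ⊢
  rw [← finProdFinEquiv.sum_comp, Fintype.sum_prod_type]
  refine Finset.sum_congr rfl fun i _ => ?_
  refine Eq.trans (Finset.sum_congr rfl fun j _ => ?_)
    (hψ i (u.1 i, u.2 i) (v.1 i, v.2 i))
  have h := Prod.ext_iff.1 (finProdFinEquiv.symm_apply_apply (i, j))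
  simp only [finProdFinEquiv_symm_apply] at h
  simp only [expand, AddEquiv.coe_mk, Equiv.coe_fn_mk, h.1, h.2]

theorem block_ne_zero_of_expand {E F : Type*} [AddCommGroup E] [AddCommGroup F] {n m : ℕ}
    (ψ : Fin n → (E × E) ≃+ SV F m) (v : SV E n) (k : Fin (n * m))
    (hk : (expand ψ v).1 k ≠ 0 ∨ (expand ψ v).2 k ≠ 0) :
    v.1 k.divNat ≠ 0 ∨ v.2 k.divNat ≠ 0 := by
  contrapose! hk
  simp [expand, hk.1, hk.2, Prod.mk_zero_zero]

theorem swt_le_swt_expand {E F : Type*} [AddCommGroup E] [AddCommGroup F] {n m : ℕ}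
    (ψ : Fin n → (E × E) ≃+ SV F m) (v : SV E n) : swt v ≤ swt (expand ψ v) := by
  refine Nat.card_le_card_of_surjective
    (fun k => ⟨k.1.divNat, block_ne_zero_of_expand ψ v k.1 k.2⟩) fun ⟨i, hi⟩ => ?_
  by_contra! hne
  have hz : ψ i (v.1 i, v.2 i) = 0 := by
    have hij (j : Fin m) : (ψ i (v.1 i, v.2 i)).1 j = 0 ∧ (ψ i (v.1 i, v.2 i)).2 j = 0 := by
      have h := Prod.ext_iff.1 (finProdFinEquiv.symm_apply_apply (i, j))
      simp only [finProdFinEquiv_symm_apply] at h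
      by_contra hc
      refine hne ⟨finProdFinEquiv (i, j), ?_⟩ (Subtype.ext h.1)
      simp only [expand, AddEquiv.coe_mk, Equiv.coe_fn_mk, h.1, h.2]
      tauto
    ext j
    · exact (hij j).1
    · exact (hij j).2
  rw [map_eq_zero_iff _ (ψ i).injective, Prod.mk_eq_zero] at hz
  tauto

theorem swt_expand_le {E F : Type*} [AddCommGroup E] [AddCommGroup F] {n m : ℕ}
    (ψ : Fin n → (E × E) ≃+ SV F m) (v : SV E n) : swt (expand ψ v) ≤ swt v * m := by
  have h := Nat.card_le_card_of_injective
    (fun k : {k // (expand ψ v).1 k ≠ 0 ∨ (expand ψ v).2 k ≠ 0} =>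
      ((⟨k.1.divNat, block_ne_zero_of_expand ψ v k.1 k.2⟩, k.1.modNat) :
        {i : Fin n // v.1 i ≠ 0 ∨ v.2 i ≠ 0} × Fin m)) fun k l hkl => by
    simp only [Prod.mk.injEq, Subtype.mk.injEq] at hkl
    exact Subtype.ext (finProdFinEquiv.symm.injective (Prod.ext hkl.1 hkl.2))
  simpa [swt, Nat.card_prod] using h

theorem swt_expand_le_swt {E F : Type*} [AddCommGroup E] [AddCommGroup F] {n m : ℕ}
    (ψ : Fin n → (E × E) ≃+ SV F m) (v : SV E n)
    (hv : ∀ i, ∃ j, ∀ k, (ψ i (v.1 i, v.2 i)).1 k ≠ 0 ∨ (ψ i (v.1 i, v.2 i)).2 k ≠ 0 → k = j) :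
    swt (expand ψ v) ≤ swt v := by
  choose j hj using hv
  refine Nat.card_le_card_of_injective
    (fun k => ⟨k.1.divNat, block_ne_zero_of_expand ψ v k.1 k.2⟩) fun k l hkl => ?_
  simp only [Subtype.mk.injEq] at hkl
  refine Subtype.ext (finProdFinEquiv.symm.injective (Prod.ext hkl ?_))
  have hk := hj k.1.divNat k.1.modNat k.2
  have hl := hj l.1.divNat l.1.modNat l.2
  rw [← hkl] at hl
  exact hk.trans hl.symm

theorem swtSet_le {F : Type*} [Zero F] {n : ℕ} {S : Set (SV F n)} {v : SV F n} (hv : v ∈ S)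
    (h0 : v ≠ 0) : swtSet S ≤ swt v :=
  Nat.sInf_le ⟨v, ⟨hv, h0⟩, rfl⟩

theorem swtSet_eq_zero_or_exists {F : Type*} [Zero F] {n : ℕ} (S : Set (SV F n)) :
    ((∀ v ∈ S, v = 0) ∧ swtSet S = 0) ∨ ∃ v ∈ S, v ≠ 0 ∧ swt v = swtSet S := by
  rcases Set.eq_empty_or_nonempty (swt '' {v | v ∈ S ∧ v ≠ 0}) with h | h
  · refine Or.inl ⟨fun v hv => ?_, by simp [swtSet, h]⟩
    by_contra h0
    exact h.subset ⟨v, ⟨hv, h0⟩, rfl⟩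
  · obtain ⟨v, ⟨hv, h0⟩, h⟩ := Nat.sInf_mem h
    exact Or.inr ⟨v, hv, h0, h⟩

theorem swtSet_le_mul_swtSet_image {F E : Type*} [AddCommGroup F] [AddCommGroup E] {n N c : ℕ}
    (Φ : SV E n ≃+ SV F N) (hΦ : ∀ v, swt v ≤ swt (Φ v) * c) (S : Set (SV E n)) :
    swtSet S ≤ swtSet (Φ '' S) * c := by
  rcases swtSet_eq_zero_or_exists (Φ '' S) with ⟨h, h'⟩ | ⟨_, ⟨v, hv, rfl⟩, h0, h⟩
  · rcases swtSet_eq_zero_or_exists S with ⟨_, h2⟩ | ⟨v, hv, h0, _⟩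
    · simp [h2]
    · exact absurd (h _ ⟨v, hv, rfl⟩) (by simpa using h0)
  · rw [← h]
    exact (swtSet_le hv (by simpa using h0)).trans (hΦ v)

section transport

variable {p : ℕ} {F E : Type*} [Field F] [Fintype F] [CharP F p] [Field E] [Fintype E]
  [CharP E p] {n N : ℕ}

theorem sdual_image (Φ : SV E n ≃+ SV F N) (hΦ : ∀ u v, trSymp p (Φ u) (Φ v) = trSymp p u v)
    (S : Set (SV E n)) : sdual p (Φ '' S) = Φ '' sdual p S := by
  ext v
  obtain ⟨v, rfl⟩ := Φ.surjective v
  rw [Φ.injective.mem_set_image]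
  simp only [sdual, Set.mem_ofPred_eq, Set.forall_mem_image, hΦ]

theorem inter_sdual_map (Φ : SV E n ≃+ SV F N)
    (hΦ : ∀ u v, trSymp p (Φ u) (Φ v) = trSymp p u v) (C : AddSubgroup (SV E n)) :
    (C.map Φ.toAddMonoidHom : Set (SV F N)) ∩ sdual p (C.map Φ.toAddMonoidHom : Set (SV F N)) =
      Φ '' ((C : Set (SV E n)) ∩ sdual p (C : Set (SV E n))) := by
  rw [Set.image_inter Φ.injective, ← sdual_image Φ hΦ]
  rfl

/-- A trace-symplectic isometry transports everything but the distance. -/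
theorem IsSubsystemCode.map (Φ : SV E n ≃+ SV F N)
    (hΦ : ∀ u v, trSymp p (Φ u) (Φ v) = trSymp p u v)
    (hcard : Fintype.card F ^ (2 * N) = Fintype.card E ^ (2 * n)) {K R d : ℕ}
    {C : AddSubgroup (SV E n)} (hC : IsSubsystemCode p K R d C) :
    IsSubsystemCode p K R
      (if sdual p ((C : Set (SV E n)) ∩ sdual p (C : Set (SV E n))) = (C : Set (SV E n))
        then swtSet (Φ '' sdual p ((C : Set (SV E n)) ∩ sdual p (C : Set (SV E n))))
        else swtSet (Φ '' (sdual p ((C : Set (SV E n)) ∩ sdual p (C : Set (SV E n))) \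
          (C : Set (SV E n)))))
      (C.map Φ.toAddMonoidHom) := by
  obtain ⟨h0, hK, hR, -⟩ := hC
  have hcC : Nat.card (C.map Φ.toAddMonoidHom) = Nat.card C :=
    Nat.card_image_of_injective Φ.injective (C : Set (SV E n))
  have hcoe : (C.map Φ.toAddMonoidHom : Set (SV F N)) = Φ '' (C : Set (SV E n)) := rfl
  refine ⟨fun h => h0 ?_, ?_, ?_, ?_⟩
  · rwa [AddSubgroup.map_eq_bot_iff_of_injective _ Φ.injective] at h
  · rw [inter_sdual_map Φ hΦ, hcC, Nat.card_image_of_injective Φ.injective, hK, hcard]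
  · rw [inter_sdual_map Φ hΦ, hcC, Nat.card_image_of_injective Φ.injective, hR]
  · rw [inter_sdual_map Φ hΦ, sdual_image Φ hΦ, hcoe, ← Set.image_sdiff Φ.injective]
    simp only [Φ.injective.image_injective.eq_iff]

end transport

/-- Field reduction/expansion: a pure `((n,K,R,d))_{q^m}` subsystem code gives a pure
`((nm,K,R,≥d))_q` subsystem code, and conversely a pure `((nm,K,R,d))_q` subsystem code gives an
`((n,K,R,≥⌊d/m⌋))_{q^m}` subsystem code. -/
theorem stmt18 {p : ℕ} [Fact p.Prime] {F E : Type} [Field F] [Fintype F] [CharP F p]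
    [Field E] [Fintype E] [CharP E p] {m : ℕ} (hm : 0 < m)
    (hcard : Fintype.card E = Fintype.card F ^ m) {n : ℕ} :
    (∀ (K R d : ℕ) (C : AddSubgroup (SV E n)),
      IsSubsystemCode p K R d C → PureTo p d C →
      ∃ (C' : AddSubgroup (SV F (n * m))) (d' : ℕ), d ≤ d' ∧
        IsSubsystemCode p K R d' C' ∧ PureTo p d' C') ∧
    (∀ (K R d : ℕ) (C : AddSubgroup (SV F (n * m))),
      IsSubsystemCode p K R d C → PureTo p d C →
      ∃ (C'' : AddSubgroup (SV E n)) (d'' : ℕ), d / m ≤ d'' ∧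
        IsSubsystemCode p K R d'' C'') := by
  have hpow : Fintype.card F ^ (2 * (n * m)) = Fintype.card E ^ (2 * n) := by
    rw [hcard, ← pow_mul]
    ring
  constructor
  · intro K R d C hC hpure
    set D : Set (SV E n) := (C : Set (SV E n)) ∩ sdual p (C : Set (SV E n)) with hD
    obtain ⟨v, hv⟩ : ∃ v : SV E n, (∀ u ∈ sdual p D \ (C : Set (SV E n)), u = 0) ∨
        (v ∈ sdual p D \ (C : Set (SV E n)) ∧ v ≠ 0 ∧
          swt v = swtSet (sdual p D \ (C : Set (SV E n)))) := by
      rcases swtSet_eq_zero_or_exists (sdual p D \ (C : Set (SV E n))) with h | ⟨v, h⟩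
      · exact ⟨0, Or.inl h.1⟩
      · exact ⟨v, Or.inr h⟩
    choose ψ hψ hw using fun i : Fin n =>
      exists_block_addEquiv (p := p) hm hcard (v.1 i, v.2 i)
    have hle (S : Set (SV E n)) : swtSet S ≤ swtSet (expand ψ '' S) := by
      simpa using swtSet_le_mul_swtSet_image (c := 1) (expand ψ)
        (fun v => by simpa using swt_le_swt_expand ψ v) S
    have hd := hC.2.2.2
    refine ⟨_, _, ?_, hC.map (expand ψ) (trSymp_expand ψ hψ) hpow, ?_⟩
    · rw [hd]
      split_ifs <;> exact hle _
    · rw [PureTo, inter_sdual_map _ (trSymp_expand ψ hψ), sdual_image _ (trSymp_expand ψ hψ)]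
      rw [PureTo] at hpure
      simp only [← hD] at hd hpure ⊢
      split_ifs with hDC
      · exact le_rfl
      rw [if_neg hDC] at hd
      rcases hv with h0 | ⟨hvS, hv0, hvd⟩
      · rcases swtSet_eq_zero_or_exists (expand ψ '' (sdual p D \ (C : Set (SV E n)))) with
          h | ⟨_, ⟨u, hu, rfl⟩, hne, -⟩
        · rw [h.2]
          exact Nat.zero_le _
        · exact absurd (h0 u hu) (by simpa using hne)
      · calc swtSet (expand ψ '' (sdual p D \ (C : Set (SV E n)))) ≤ swt (expand ψ v) :=
              swtSet_le ⟨v, hvS, rfl⟩ (by simpa using hv0)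
          _ ≤ swt v := swt_expand_le_swt ψ v hw
          _ = d := hvd.trans hd.symm
          _ ≤ swtSet (sdual p D) := hpure
          _ ≤ _ := hle _
  · intro K R d C hC _
    choose ψ hψ _ using fun _ : Fin n => exists_block_addEquiv (p := p) hm hcard (0 : E × E)
    have hΦ (u v : SV F (n * m)) :
        trSymp p ((expand ψ).symm u) ((expand ψ).symm v) = trSymp p u v := by
      rw [← trSymp_expand ψ hψ, AddEquiv.apply_symm_apply, AddEquiv.apply_symm_apply]
    refine ⟨_, _, ?_, hC.map (expand ψ).symm hΦ hpow.symm⟩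
    have hle := swtSet_le_mul_swtSet_image (expand ψ).symm fun v => by
      simpa using swt_expand_le ψ ((expand ψ).symm v)
    refine Nat.div_le_of_le_mul ?_
    rw [hC.2.2.2]
    split_ifs <;> exact (hle _).trans_eq (mul_comm _ _)
end
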